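/- Let (Ω, F, P) be a probability space with filtration (F_t)_{t=0}^T, T ≥ 1 an integer, and (β_t)_{t=1}^T adapted and integrable. Fix ε > 0 and an integer t with 1 ≤ t ≤ T − 2. Suppose that for every s ≤ t: (i) |β_s − E[β_s | F_{s−1}]| ≤ (1 + ε)/(T − s) almost surely, and (ii) |Σ_{k=1}^s E[β_k | F_{k−1}]| ≤ 2ε/3 almost surely. Then P( ∃ s ≤ t : |Σ_{k=1}^s β_k| ≥ ε ) ≤ 2·exp( −(T − t + 1)·ε² / (18(1 + ε)²) ). -/

import Mathlib

open MeasureTheory ProbabilityTheory Finset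

/-- The Gaussian moments `(2k-1)!!`, written as `(2k)!/(2^k k!)`. -/
noncomputable def gmom (k : ℕ) : ℝ := ((2 * k).factorial : ℝ) / (2 ^ k * (k.factorial : ℝ))

lemma gmom_pos (k : ℕ) : 0 < gmom k := by unfold gmom; positivity

lemma gmom_zero : gmom 0 = 1 := by simp [gmom]

lemma gmom_succ (k : ℕ) : gmom (k + 1) = (2 * k + 1) * gmom k := by
  unfold gmom
  have : (2 * (k + 1)).factorial = (2 * k + 2) * ((2 * k + 1) * (2 * k).factorial) := by
    rw [show 2 * (k + 1) = (2 * k + 1) + 1 by ring, Nat.factorial_succ, Nat.factorial_succ]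
  rw [this, Nat.factorial_succ]
  push_cast
  field_simp
  ring

lemma gmom_exp (k : ℕ) : gmom k * Real.exp k ≤ (2 * k + 1) ^ k := by
  induction k with
  | zero => simp [gmom_zero]
  | succ k ih =>
    have hk : (0 : ℝ) < 2 * k + 1 := by positivity
    have h1 : Real.exp 1 ≤ ((2 * k + 3) / (2 * k + 1) : ℝ) ^ (k + 1) := by
      have h := Real.le_log_one_add_of_nonneg (x := 2 / (2 * k + 1)) (by positivity)
      have e1 : 2 * (2 / (2 * k + 1) : ℝ) / (2 / (2 * k + 1) + 2) = 1 / (k + 1) := by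
        field_simp; ring
      have e2 : (1 + 2 / (2 * k + 1) : ℝ) = (2 * k + 3) / (2 * k + 1) := by
        field_simp; ring
      rw [e1, e2] at h
      have hp : (0 : ℝ) < (2 * k + 3) / (2 * k + 1) := by positivity
      rw [← Real.exp_log (pow_pos hp (k + 1)), Real.exp_le_exp, Real.log_pow]
      push_cast
      have : (0 : ℝ) < k + 1 := by positivity
      rw [div_le_iff₀ this] at h
      linarith
    rw [gmom_succ]
    push_cast
    rw [Real.exp_add]
    rw [div_pow, le_div_iff₀ (by positivity)] at h1
    calc (2 * (k : ℝ) + 1) * gmom k * (Real.exp k * Real.exp 1)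
        = (2 * k + 1) * Real.exp 1 * (gmom k * Real.exp k) := by ring
      _ ≤ (2 * k + 1) * Real.exp 1 * (2 * k + 1) ^ k := by gcongr
      _ = Real.exp 1 * (2 * k + 1) ^ (k + 1) := by ring
      _ ≤ (2 * k + 3) ^ (k + 1) := h1
      _ = _ := by ring

lemma gmom_log (k : ℕ) : Real.log (gmom k) + k ≤ k * Real.log (2 * k + 1) := by
  have h := Real.log_le_log (by have := gmom_pos k; positivity) (gmom_exp k)
  rwa [Real.log_mul (gmom_pos k).ne' (Real.exp_pos _).ne', Real.log_exp, Real.log_pow] at h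

lemma exists_gmom (y : ℝ) (hy : 0 < y) :
    ∃ k : ℕ, gmom k / (2 * y) ^ k ≤ Real.exp (1 / 2 - y) := by
  obtain ⟨k, hk⟩ : ∃ k : ℕ, k = ⌊y + 1 / 2⌋₊ := ⟨_, rfl⟩
  have hk1 : (k : ℝ) ≤ y + 1 / 2 := by rw [hk]; exact Nat.floor_le (by positivity)
  have hk2 : y + 1 / 2 < k + 1 := by rw [hk]; exact Nat.lt_floor_add_one _
  refine ⟨k, ?_⟩
  rcases k with _ | j
  · simp only [gmom_zero, pow_zero, div_one]
    rw [Real.one_le_exp_iff]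
    push_cast at hk2
    linarith
  push_cast at hk1 hk2
  have hgl1 := gmom_log (j + 1)
  have hgl2 := gmom_log j
  have hgs : Real.log (gmom (j + 1)) = Real.log (2 * j + 1) + Real.log (gmom j) := by
    rw [gmom_succ, Real.log_mul (by positivity) (gmom_pos j).ne']
  have hconc : ConcaveOn ℝ (Set.Ioi (0 : ℝ)) (fun z => ((j : ℝ) + 1) * Real.log z - z) := by
    have h1 := (strictConcaveOn_log_Ioi.concaveOn).smul (c := (j : ℝ) + 1) (by positivity)
    exact h1.sub (convexOn_id (convex_Ioi 0))
  have hmin := hconc.min_le_of_mem_Icc (x := (j : ℝ) + 1 / 2) (y := (j : ℝ) + 3 / 2) (z := y)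
    (Set.mem_Ioi.2 (by positivity)) (Set.mem_Ioi.2 (by positivity))
    ⟨by linarith, by linarith⟩
  have el : Real.log (2 * j + 1) = Real.log 2 + Real.log ((j : ℝ) + 1 / 2) := by
    rw [← Real.log_mul (by norm_num) (by positivity)]; ring_nf
  have er : Real.log (2 * ((j + 1 : ℕ) : ℝ) + 1) = Real.log 2 + Real.log ((j : ℝ) + 3 / 2) := by
    rw [← Real.log_mul (by norm_num) (by positivity)]; push_cast; ring_nf
  have key : Real.log (gmom (j + 1)) ≤ ((j : ℝ) + 1) * Real.log (2 * y) + (1 / 2 - y) := by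
    rw [Real.log_mul (by norm_num) hy.ne']
    rw [er] at hgl1
    rw [el] at hgl2 hgs
    push_cast at hgl1
    rcases min_le_iff.1 hmin with h | h
    · nlinarith
    · nlinarith
  rw [div_le_iff₀ (by positivity), ← Real.exp_log (gmom_pos (j + 1)),
    ← Real.exp_log (pow_pos (by positivity : 0 < 2 * y) (j + 1)), ← Real.exp_add, Real.exp_le_exp,
    Real.log_pow]
  push_cast
  linarith

lemma two_pow_fact (i : ℕ) : 2 ^ i * i.factorial ≤ (2 * i).factorial := by
  induction i with
  | zero => simp
  | succ i ih =>
    rw [show 2 * (i + 1) = (2 * i + 1) + 1 by ring, Nat.factorial_succ, Nat.factorial_succ,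
      Nat.factorial_succ, pow_succ]
    nlinarith [Nat.zero_le (i * (2 * i).factorial), Nat.zero_le (i * i * (2 * i).factorial)]

lemma choose_gmom (k i : ℕ) (hi : i ≤ k) :
    ((2 * k).choose (2 * i) : ℝ) * gmom (k - i) ≤ gmom k * (k.choose i : ℝ) := by
  obtain ⟨j, rfl⟩ := Nat.exists_eq_add_of_le hi
  rw [Nat.cast_choose ℝ (by omega : 2 * i ≤ 2 * (i + j)), Nat.cast_choose ℝ hi]
  rw [show 2 * (i + j) - 2 * i = 2 * j by omega, show i + j - i = j by omega]
  unfold gmom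
  have h : (2 ^ i * i.factorial : ℝ) ≤ (2 * i).factorial := by exact_mod_cast two_pow_fact i
  have e1 : ((2 * (i + j)).factorial : ℝ) / ((2 * i).factorial * (2 * j).factorial) *
      ((2 * j).factorial / (2 ^ j * j.factorial)) =
      ((2 * (i + j)).factorial / (2 ^ j * j.factorial)) * (1 / (2 * i).factorial) := by
    field_simp
  have e2 : ((2 * (i + j)).factorial : ℝ) / (2 ^ (i + j) * (i + j).factorial) *
      ((i + j).factorial / (i.factorial * j.factorial)) =
      ((2 * (i + j)).factorial / (2 ^ j * j.factorial)) * (1 / (2 ^ i * i.factorial)) := by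
    rw [pow_add]; field_simp
  rw [e1, e2]
  gcongr

lemma sum_even (h : ℕ → ℝ) (k : ℕ) :
    ∑ j ∈ range (2 * k + 1), h j * ((1 + (-1) ^ j) / 2) = ∑ i ∈ range (k + 1), h (2 * i) := by
  induction k with
  | zero => simp
  | succ k ih =>
    rw [show 2 * (k + 1) + 1 = (2 * k + 1) + 1 + 1 by ring, sum_range_succ, sum_range_succ, ih,
      sum_range_succ _ (k + 1)]
    have h1 : (-1 : ℝ) ^ (2 * k + 1) = -1 := by rw [pow_succ, pow_mul]; simp
    have h2 : (-1 : ℝ) ^ (2 * k + 1 + 1) = 1 := by rw [pow_succ, h1]; simp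
    rw [h1, h2, show 2 * (k + 1) = 2 * k + 1 + 1 by ring]
    ring

lemma even_binom (x c : ℝ) (k : ℕ) :
    ((x + c) ^ (2 * k) + (x - c) ^ (2 * k)) / 2 =
      ∑ i ∈ range (k + 1), ((2 * k).choose (2 * i) : ℝ) * c ^ (2 * i) * x ^ (2 * (k - i)) := by
  have := sum_even (fun j => c ^ j * x ^ (2 * k - j) * ((2 * k).choose j : ℝ)) k
  rw [add_comm x c, show x - c = -c + x by ring, add_pow, add_pow, ← sum_add_distrib, sum_div]
  calc _ = ∑ j ∈ range (2 * k + 1),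
        (c ^ j * x ^ (2 * k - j) * ((2 * k).choose j : ℝ)) * ((1 + (-1) ^ j) / 2) := by
        refine sum_congr rfl fun j _ => ?_
        rw [neg_pow]; ring
    _ = _ := by
        rw [this]
        refine sum_congr rfl fun i _ => ?_
        rw [show 2 * k - 2 * i = 2 * (k - i) by omega]; ring

lemma chord (x d c : ℝ) (hd : |d| ≤ c) (k : ℕ) :
    (x + d) ^ (2 * k) ≤ ((x + c) ^ (2 * k) + (x - c) ^ (2 * k)) / 2 +
      ((x + c) ^ (2 * k) - (x - c) ^ (2 * k)) / (2 * c) * d := by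
  obtain ⟨h1, h2⟩ := abs_le.1 hd
  rcases (abs_nonneg d |>.trans hd).eq_or_lt with h | h
  · have : d = 0 := by linarith
    subst this
    rw [← h]
    simp
  have hc := (Even.convexOn_pow (𝕜 := ℝ) (even_two_mul k)).2 (Set.mem_univ (x + c))
    (Set.mem_univ (x - c)) (show 0 ≤ (c + d) / (2 * c) from div_nonneg (by linarith) (by linarith))
    (show 0 ≤ (c - d) / (2 * c) from div_nonneg (by linarith) (by linarith))
    (by field_simp; ring)
  simp only [smul_eq_mul] at hc
  have e : (c + d) / (2 * c) * (x + c) + (c - d) / (2 * c) * (x - c) = x + d := by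
    field_simp; ring
  rw [e] at hc
  refine hc.trans (le_of_eq ?_)
  field_simp
  ring

section mart

variable {Ω : Type*} {m0 : MeasurableSpace Ω} {P : Measure Ω} [IsProbabilityMeasure P]
  {F : Filtration ℕ m0} {d : ℕ → Ω → ℝ} {c : ℕ → ℝ}

lemma M_meas (hm : ∀ k, StronglyMeasurable[F (k + 1)] (d k)) (n : ℕ) :
    StronglyMeasurable[F n] (fun ω => ∑ k ∈ range n, d k ω) := by
  refine Finset.stronglyMeasurable_fun_sum _ fun k hk => ?_
  exact (hm k).mono (F.mono (by have := mem_range.1 hk; omega))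

lemma M_bdd (hb : ∀ k, ∀ᵐ ω ∂P, |d k ω| ≤ c k) (n : ℕ) :
    ∀ᵐ ω ∂P, |∑ k ∈ range n, d k ω| ≤ ∑ k ∈ range n, c k := by
  filter_upwards [ae_all_iff.2 hb] with ω hω
  exact (abs_sum_le_sum_abs _ _).trans (sum_le_sum fun k _ => hω k)

/-- continuous functions of the partial sums are integrable -/
lemma gM_bdd (hb : ∀ k, ∀ᵐ ω ∂P, |d k ω| ≤ c k) (n : ℕ) (g : ℝ → ℝ) (hg : Continuous g) :
    ∃ C, ∀ᵐ ω ∂P, ‖g (∑ k ∈ range n, d k ω)‖ ≤ C := by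
  obtain ⟨C, hC⟩ := (isCompact_Icc (a := -∑ k ∈ range n, c k)
    (b := ∑ k ∈ range n, c k)).exists_bound_of_continuousOn hg.continuousOn
  refine ⟨C, ?_⟩
  filter_upwards [M_bdd hb n] with ω hω
  exact hC _ (abs_le.1 hω)

lemma gM_int (hm : ∀ k, StronglyMeasurable[F (k + 1)] (d k))
    (hb : ∀ k, ∀ᵐ ω ∂P, |d k ω| ≤ c k) (n : ℕ) (g : ℝ → ℝ) (hg : Continuous g) :
    Integrable (fun ω => g (∑ k ∈ range n, d k ω)) P := by
  obtain ⟨C, hC⟩ := gM_bdd hb n g hg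
  exact Integrable.of_bound
    (hg.comp_stronglyMeasurable ((M_meas hm n).mono (F.le n))).aestronglyMeasurable C hC

lemma d_int (hm : ∀ k, StronglyMeasurable[F (k + 1)] (d k))
    (hb : ∀ k, ∀ᵐ ω ∂P, |d k ω| ≤ c k) (n : ℕ) : Integrable (d n) P :=
  Integrable.of_bound ((hm n).mono (F.le _)).aestronglyMeasurable (c n) (hb n)

lemma gM_d_int (hm : ∀ k, StronglyMeasurable[F (k + 1)] (d k))
    (hb : ∀ k, ∀ᵐ ω ∂P, |d k ω| ≤ c k) (n : ℕ) (g : ℝ → ℝ) (hg : Continuous g) :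
    Integrable (fun ω => g (∑ k ∈ range n, d k ω) * d n ω) P := by
  obtain ⟨C, hC⟩ := gM_bdd hb n g hg
  exact (d_int hm hb n).bdd_mul (gM_int hm hb n g hg).aestronglyMeasurable hC

lemma gM_d_zero (hm : ∀ k, StronglyMeasurable[F (k + 1)] (d k))
    (hb : ∀ k, ∀ᵐ ω ∂P, |d k ω| ≤ c k) (hz : ∀ k, P[d k | F k] =ᵐ[P] 0)
    (n : ℕ) (g : ℝ → ℝ) (hg : Continuous g) :
    ∫ ω, g (∑ k ∈ range n, d k ω) * d n ω ∂P = 0 := by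
  have h := condExp_mul_of_stronglyMeasurable_left (m := F n)
    (hg.comp_stronglyMeasurable (M_meas hm n)) (gM_d_int hm hb n g hg) (d_int hm hb n)
  rw [← integral_condExp (F.le n)]
  have h0 : P[fun ω => g (∑ k ∈ range n, d k ω) * d n ω | F n] =ᵐ[P] 0 := by
    refine h.trans ?_
    filter_upwards [hz n] with ω hω
    simp [hω]
  rw [integral_congr_ae h0]
  simp

lemma moment (hm : ∀ k, StronglyMeasurable[F (k + 1)] (d k))
    (hb : ∀ k, ∀ᵐ ω ∂P, |d k ω| ≤ c k) (hz : ∀ k, P[d k | F k] =ᵐ[P] 0) (n : ℕ) :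
    ∀ k : ℕ, ∫ ω, (∑ j ∈ range n, d j ω) ^ (2 * k) ∂P ≤
      gmom k * (∑ j ∈ range n, c j ^ 2) ^ k := by
  induction n with
  | zero =>
    intro k
    rcases k with _ | k
    · simp [gmom_zero]
    · simp
  | succ n ih =>
    intro k
    have hg : Continuous fun x : ℝ =>
      ((x + c n) ^ (2 * k) - (x - c n) ^ (2 * k)) / (2 * c n) := by fun_prop
    have hi := gM_d_int hm hb n _ hg
    have hi0 := gM_d_zero hm hb hz n _ hg
    have hi1 := gM_int hm hb n
      (fun x => ((x + c n) ^ (2 * k) + (x - c n) ^ (2 * k)) / 2) (by fun_prop)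
    calc ∫ ω, (∑ j ∈ range (n + 1), d j ω) ^ (2 * k) ∂P
        ≤ ∫ ω, ((((∑ j ∈ range n, d j ω) + c n) ^ (2 * k)
            + ((∑ j ∈ range n, d j ω) - c n) ^ (2 * k)) / 2 +
          ((((∑ j ∈ range n, d j ω) + c n) ^ (2 * k)
            - ((∑ j ∈ range n, d j ω) - c n) ^ (2 * k)) / (2 * c n)) * d n ω) ∂P := by
          refine integral_mono_ae (gM_int hm hb (n + 1) (fun x => x ^ (2 * k)) (by fun_prop))
            (hi1.add hi) ?_
          filter_upwards [hb n] with ω hω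
          rw [sum_range_succ]
          exact chord _ _ _ hω k
      _ = ∫ ω, ((((∑ j ∈ range n, d j ω) + c n) ^ (2 * k)
            + ((∑ j ∈ range n, d j ω) - c n) ^ (2 * k)) / 2) ∂P := by
          rw [integral_add hi1 hi, hi0, add_zero]
      _ = ∑ i ∈ range (k + 1), ((2 * k).choose (2 * i) : ℝ) * c n ^ (2 * i) *
            ∫ ω, (∑ j ∈ range n, d j ω) ^ (2 * (k - i)) ∂P := by
          simp_rw [even_binom]
          rw [integral_finsetSum]
          · simp_rw [integral_const_mul]
          · intro i _
            exact (gM_int hm hb n (fun x => x ^ (2 * (k - i))) (by fun_prop)).const_mul _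
      _ ≤ ∑ i ∈ range (k + 1), ((2 * k).choose (2 * i) : ℝ) * c n ^ (2 * i) *
            (gmom (k - i) * (∑ j ∈ range n, c j ^ 2) ^ (k - i)) := by
          refine sum_le_sum fun i _ => mul_le_mul_of_nonneg_left (ih _) ?_
          rw [pow_mul]; positivity
      _ ≤ ∑ i ∈ range (k + 1), gmom k * ((c n ^ 2) ^ i *
            (∑ j ∈ range n, c j ^ 2) ^ (k - i) * (k.choose i : ℝ)) := by
          refine sum_le_sum fun i hi => ?_
          have h := choose_gmom k i (by have := mem_range.1 hi; omega)
          have hp : 0 ≤ (c n ^ 2) ^ i * (∑ j ∈ range n, c j ^ 2) ^ (k - i) := by positivity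
          have := mul_le_mul_of_nonneg_right h hp
          rw [pow_mul]
          linarith
      _ = gmom k * (∑ j ∈ range (n + 1), c j ^ 2) ^ k := by
          rw [← mul_sum, ← add_pow, sum_range_succ, add_comm (c n ^ 2)]

lemma submart (hm : ∀ k, StronglyMeasurable[F (k + 1)] (d k))
    (hb : ∀ k, ∀ᵐ ω ∂P, |d k ω| ≤ c k) (hz : ∀ k, P[d k | F k] =ᵐ[P] 0) (k : ℕ) :
    Submartingale (fun n ω => (∑ j ∈ range n, d j ω) ^ (2 * k)) F P := by
  have hpm : ∀ n, Integrable (fun ω => (∑ j ∈ range n, d j ω) ^ (2 * k)) P := fun n =>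
    gM_int hm hb n (fun x => x ^ (2 * k)) (by fun_prop)
  have hM : ∀ n, Integrable (fun ω => ∑ j ∈ range n, d j ω) P := fun n =>
    gM_int hm hb n (fun x => x) (by fun_prop)
  refine submartingale_nat (fun n => ?_) hpm ?_
  · exact (continuous_pow (2 * k)).comp_stronglyMeasurable (M_meas hm n)
  · intro n
    have hJ := (Even.convexOn_pow (𝕜 := ℝ) (even_two_mul k)).map_condExp_le_univ (F.le n)
      ((continuous_pow (2 * k)).lowerSemicontinuous) (hM (n + 1)) (hpm (n + 1))
    have hs : P[fun ω => ∑ j ∈ range (n + 1), d j ω | F n] =ᵐ[P]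
        fun ω => ∑ j ∈ range n, d j ω := by
      have e : (fun ω => ∑ j ∈ range (n + 1), d j ω) = (fun ω => ∑ j ∈ range n, d j ω) + d n := by
        ext ω; simp [sum_range_succ]
      rw [e]
      have h1 := condExp_add (hM n) (d_int hm hb n) (F n)
      rw [condExp_of_stronglyMeasurable (F.le n) (M_meas hm n) (hM n)] at h1
      filter_upwards [h1, hz n] with ω h1 h2
      rw [h1]; simp [h2]
    filter_upwards [hJ, hs] with ω h1 h2
    rw [Function.comp_apply, h2] at h1
    exact h1

lemma max_bound (hm : ∀ k, StronglyMeasurable[F (k + 1)] (d k))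
    (hb : ∀ k, ∀ᵐ ω ∂P, |d k ω| ≤ c k) (hz : ∀ k, P[d k | F k] =ᵐ[P] 0)
    (k t : ℕ) (a : ℝ) (ha : 0 < a) :
    P {ω | ∃ s : ℕ, s ≤ t ∧ a ≤ |∑ j ∈ range s, d j ω|} ≤
      ENNReal.ofReal (gmom k * (∑ j ∈ range t, c j ^ 2) ^ k / a ^ (2 * k)) := by
  have hmax := maximal_ineq (submart hm hb hz k)
    (fun n ω => (even_two_mul k).pow_nonneg _) (ε := (a ^ (2 * k)).toNNReal) t
  have hcoe : (((a ^ (2 * k)).toNNReal : NNReal) : ℝ) = a ^ (2 * k) :=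
    Real.coe_toNNReal _ (by positivity)
  rw [hcoe] at hmax
  set A := {ω | a ^ (2 * k) ≤ (range (t + 1)).sup' nonempty_range_add_one
    fun n => (∑ j ∈ range n, d j ω) ^ (2 * k)} with hA
  have hsub : {ω | ∃ s : ℕ, s ≤ t ∧ a ≤ |∑ j ∈ range s, d j ω|} ⊆ A := by
    rintro ω ⟨s, hs, h⟩
    rw [hA, Set.mem_ofPred_eq, le_sup'_iff]
    refine ⟨s, mem_range.2 (by omega), ?_⟩
    rw [← (even_two_mul k).pow_abs (∑ j ∈ range s, d j ω)]
    gcongr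
  refine (measure_mono hsub).trans ?_
  have hle : ENNReal.ofReal (∫ ω in A, (∑ j ∈ range t, d j ω) ^ (2 * k) ∂P) ≤
      ENNReal.ofReal (gmom k * (∑ j ∈ range t, c j ^ 2) ^ k) := by
    refine ENNReal.ofReal_le_ofReal (le_trans ?_ (moment hm hb hz t k))
    exact setIntegral_le_integral (gM_int hm hb t (fun x => x ^ (2 * k)) (by fun_prop))
      (ae_of_all _ fun ω => (even_two_mul k).pow_nonneg _)
  rw [ENNReal.ofReal_div_of_pos (by positivity), ENNReal.le_div_iff_mul_le
    (Or.inl (by positivity)) (Or.inl ENNReal.ofReal_ne_top), mul_comm]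
  exact hmax.trans hle

end mart

lemma sum_sq (T t : ℕ) (h : t + 2 ≤ T) :
    ∑ j ∈ range t, (1 / ((T : ℝ) - ((j : ℝ) + 1))) ^ 2 ≤ 1 / ((T : ℝ) - t - 1 / 2) := by
  have key : ∀ s, s ≤ t → ∑ j ∈ range s, (1 / ((T : ℝ) - ((j : ℝ) + 1))) ^ 2 ≤
      1 / ((T : ℝ) - s - 1 / 2) - 1 / ((T : ℝ) - 1 / 2) := by
    intro s
    induction s with
    | zero => simp
    | succ s ih =>
      intro hs
      have h1 : ((s : ℝ) + 1) + 2 ≤ T := by exact_mod_cast (by omega : s + 1 + 2 ≤ T)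
      rw [sum_range_succ]
      have := ih (by omega)
      have h2 : (1 / ((T : ℝ) - ((s : ℝ) + 1))) ^ 2 ≤
          1 / ((T : ℝ) - ((s : ℝ) + 1) - 1 / 2) - 1 / ((T : ℝ) - s - 1 / 2) := by
        obtain ⟨u, hu⟩ : ∃ u : ℝ, u = (T : ℝ) - ((s : ℝ) + 1) := ⟨_, rfl⟩
        have hu2 : 2 ≤ u := by linarith
        rw [show (T : ℝ) - s - 1 / 2 = u + 1 / 2 by linarith, ← hu,
          div_sub_div _ _ (by linarith) (by linarith), one_div_pow]
        rw [div_le_div_iff₀ (by positivity) (by nlinarith)]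
        nlinarith
      push_cast
      linarith
  have h1 : (t : ℝ) + 2 ≤ T := by exact_mod_cast h
  have h2 := key t le_rfl
  have h3 : 0 ≤ 1 / ((T : ℝ) - 1 / 2) := one_div_nonneg.2 (by
    have : (0 : ℝ) ≤ t := by positivity
    linarith)
  linarith

/-- Drift-plus-martingale bound: if the adapted, integrable process `(β_t)`
satisfies, for all `s ≤ t` (with `1 ≤ t ≤ T − 2`),
(i) `|β_s − E[β_s | F_{s−1}]| ≤ (1+ε)/(T−s)` a.s. and
(ii) `|Σ_{k=1}^s E[β_k | F_{k−1}]| ≤ 2ε/3` a.s.,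
then `P(∃ s ≤ t, |Σ_{k=1}^s β_k| ≥ ε) ≤ 2·exp(−(T−t+1) ε² / (18(1+ε)²))`. -/
theorem stmt11 {Ω : Type*} {m0 : MeasurableSpace Ω} (P : Measure Ω) [IsProbabilityMeasure P]
    (T : ℕ) (hT : 1 ≤ T) (F : Filtration ℕ m0)
    (β : ℕ → Ω → ℝ) (hadapted : Adapted F β) (hint : ∀ s, Integrable (β s) P)
    (ε : ℝ) (hε : 0 < ε)
    (t : ℕ) (ht1 : 1 ≤ t) (ht2 : t ≤ T - 2)
    (hdiff : ∀ s : ℕ, s ≤ t →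
      ∀ᵐ ω ∂P, |β s ω - (P[β s | F (s - 1)]) ω| ≤ (1 + ε) / ((T : ℝ) - s))
    (hdrift : ∀ s : ℕ, s ≤ t →
      ∀ᵐ ω ∂P, |∑ k ∈ Finset.Icc 1 s, (P[β k | F (k - 1)]) ω| ≤ 2 * ε / 3) :
    P {ω | ∃ s : ℕ, 1 ≤ s ∧ s ≤ t ∧ ε ≤ |∑ k ∈ Finset.Icc 1 s, β k ω|}
      ≤ ENNReal.ofReal
          (2 * Real.exp (-(((T : ℝ) - t + 1) * ε ^ 2) / (18 * (1 + ε) ^ 2))) := by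
  have hTt : t + 2 ≤ T := by omega
  have hTtR : (t : ℝ) + 2 ≤ T := by exact_mod_cast hTt
  -- the martingale differences
  let d : ℕ → Ω → ℝ := fun k =>
    if k + 1 ≤ t then β (k + 1) - P[β (k + 1) | F k] else 0
  let c : ℕ → ℝ := fun k => if k + 1 ≤ t then (1 + ε) / ((T : ℝ) - ((k : ℝ) + 1)) else 0
  have hm : ∀ k, StronglyMeasurable[F (k + 1)] (d k) := by
    intro k
    by_cases hk : k + 1 ≤ t
    · simp only [d, hk, if_true]
      exact (hadapted (k + 1)).stronglyMeasurable.sub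
        (stronglyMeasurable_condExp.mono (F.mono (Nat.le_succ k)))
    · simp only [d, hk, if_false]
      exact stronglyMeasurable_zero
  have hb : ∀ k, ∀ᵐ ω ∂P, |d k ω| ≤ c k := by
    intro k
    by_cases hk : k + 1 ≤ t
    · simp only [d, c, hk, if_true]
      simpa using hdiff (k + 1) hk
    · simp only [d, c, hk, if_false]
      simp
  have hz : ∀ k, P[d k | F k] =ᵐ[P] 0 := by
    intro k
    by_cases hk : k + 1 ≤ t
    · simp only [d, hk, if_true]
      have h1 := condExp_sub (hint (k + 1)) (integrable_condExp (m := F k) (f := β (k + 1))) (F k)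
      rw [condExp_of_stronglyMeasurable (F.le k) stronglyMeasurable_condExp
        integrable_condExp] at h1
      simpa using h1
    · simp only [d, hk, if_false]
      rw [condExp_zero]
  have hMs : ∀ s, s ≤ t → ∀ ω, ∑ j ∈ range s, d j ω =
      ∑ k ∈ Finset.Icc 1 s, β k ω - ∑ k ∈ Finset.Icc 1 s, (P[β k | F (k - 1)]) ω := by
    intro s
    induction s with
    | zero => simp
    | succ s ih =>
      intro hs ω
      rw [sum_range_succ, ih (by omega) ω, sum_Icc_succ_top (by omega),
        sum_Icc_succ_top (by omega)]
      simp only [d, hs, if_true, Pi.sub_apply, Nat.add_sub_cancel]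
      ring
  have hsubset : P {ω | ∃ s : ℕ, 1 ≤ s ∧ s ≤ t ∧ ε ≤ |∑ k ∈ Finset.Icc 1 s, β k ω|} ≤
      P {ω | ∃ s : ℕ, s ≤ t ∧ ε / 3 ≤ |∑ j ∈ range s, d j ω|} := by
    refine measure_mono_ae ?_
    have hall : ∀ᵐ ω ∂P, ∀ s, s ≤ t →
        |∑ k ∈ Finset.Icc 1 s, (P[β k | F (k - 1)]) ω| ≤ 2 * ε / 3 := by
      rw [ae_all_iff]
      intro s
      by_cases hs : s ≤ t
      · filter_upwards [hdrift s hs] with ω hω _ using hω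
      · exact ae_of_all _ fun ω h => absurd h hs
    filter_upwards [hall] with ω hω
    rintro ⟨s, -, hs, h⟩
    refine ⟨s, hs, ?_⟩
    rw [hMs s hs ω]
    have h1 := abs_sub_abs_le_abs_sub (∑ k ∈ Finset.Icc 1 s, β k ω)
      (∑ k ∈ Finset.Icc 1 s, (P[β k | F (k - 1)]) ω)
    have h2 := hω s hs
    linarith
  refine hsubset.trans ?_
  obtain ⟨x, hx⟩ : ∃ x : ℝ, x = ε ^ 2 / (18 * (1 + ε) ^ 2) := ⟨_, rfl⟩
  have hx0 : 0 < x := by rw [hx]; positivity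
  have hx1 : x ≤ 1 / 18 := by
    rw [hx, div_le_div_iff₀ (by positivity) (by norm_num)]
    nlinarith
  obtain ⟨r, hr⟩ : ∃ r : ℝ, r = (T : ℝ) - t - 1 / 2 := ⟨_, rfl⟩
  have hr0 : 0 < r := by linarith
  obtain ⟨k, hk⟩ := exists_gmom (r * x) (by positivity)
  refine (max_bound hm hb hz k t (ε / 3) (by positivity)).trans (ENNReal.ofReal_le_ofReal ?_)
  have hS : ∑ j ∈ range t, c j ^ 2 ≤ (1 + ε) ^ 2 / r := by
    have : ∑ j ∈ range t, c j ^ 2 =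
        (1 + ε) ^ 2 * ∑ j ∈ range t, (1 / ((T : ℝ) - ((j : ℝ) + 1))) ^ 2 := by
      rw [mul_sum]
      refine sum_congr rfl fun j hj => ?_
      have hj' : j + 1 ≤ t := mem_range.1 hj
      simp only [c, hj', if_true]
      rw [← mul_pow, mul_one_div]
    rw [this, div_eq_mul_one_div _ r, hr]
    exact mul_le_mul_of_nonneg_left (sum_sq T t hTt) (by positivity)
  have hS0 : 0 ≤ ∑ j ∈ range t, c j ^ 2 := sum_nonneg fun j _ => sq_nonneg _
  have e1 : gmom k * ((1 + ε) ^ 2 / r) ^ k / (ε / 3) ^ (2 * k) = gmom k / (2 * (r * x)) ^ k := by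
    rw [pow_mul, mul_div_assoc, ← div_pow, div_eq_mul_inv (gmom k), ← inv_pow]
    congr 2
    rw [hx]
    field_simp
    norm_num
  calc gmom k * (∑ j ∈ range t, c j ^ 2) ^ k / (ε / 3) ^ (2 * k)
      ≤ gmom k * ((1 + ε) ^ 2 / r) ^ k / (ε / 3) ^ (2 * k) := by
        have := gmom_pos k
        gcongr
    _ = gmom k / (2 * (r * x)) ^ k := e1
    _ ≤ Real.exp (1 / 2 - r * x) := hk
    _ ≤ Real.exp (Real.log 2 + -(((T : ℝ) - t + 1) * x)) := by
        rw [Real.exp_le_exp]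
        have := Real.log_two_gt_d9
        have : ((T : ℝ) - t + 1) * x = r * x + 3 / 2 * x := by rw [hr]; ring
        linarith
    _ = _ := by
        rw [Real.exp_add, Real.exp_log (by norm_num), hx, ← mul_div_assoc, neg_div]
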